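/- arXiv:1306.4562 — 3 statements merged into one kernel-verified Lean document; each statement's English description precedes it below -/
import Mathlib

section
/- Let p be an odd prime, n a positive integer, and M > 1 an integer coprime to p with p^n dividing M^{p-1} - 1. Let f be the multiplicative order of M modulo p, and let Φ_f denote the f-th cyclotomic polynomial over ℚ. Then p^n divides Φ_f(M). -/
/-- Proposition: if `p^n ∣ M^(p-1) - 1` with `M` coprime to the odd prime `p`, and
`f` is the multiplicative order of `M` modulo `p`, then `p^n` divides `Φ_f(M)`,
the value at `M` of the `f`-th cyclotomic polynomial. -/
theorem stmt_2 (p : ℕ) (hp : p.Prime) (hodd : Odd p)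
    (n : ℕ) (hn : 0 < n) (M : ℤ) (hM : 1 < M) (hcop : ¬ (p : ℤ) ∣ M)
    (hdvd : (p : ℤ) ^ n ∣ M ^ (p - 1) - 1)
    (f : ℕ) (hf : f = orderOf (M : ZMod p)) :
    (p : ℤ) ^ n ∣ (Polynomial.cyclotomic f ℤ).eval M := by
  haveI : Fact p.Prime := ⟨hp⟩
  have hpos : 0 < p - 1 := Nat.sub_pos_of_lt hp.one_lt
  have hM0 : (M : ZMod p) ≠ 0 := fun h => hcop ((ZMod.intCast_zmod_eq_zero_iff_dvd M p).1 h)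
  have hfd : f ∣ p - 1 := by
    rw [hf]
    exact orderOf_dvd_of_pow_eq_one (ZMod.pow_card_sub_one_eq_one hM0)
  have hmem : f ∈ (p - 1).divisors := Nat.mem_divisors.2 ⟨hfd, hpos.ne'⟩
  have hprod : M ^ (p - 1) - 1 = (Polynomial.cyclotomic f ℤ).eval M *
      ∏ d ∈ (p - 1).divisors.erase f, (Polynomial.cyclotomic d ℤ).eval M := by
    rw [Finset.mul_prod_erase _ (fun d => (Polynomial.cyclotomic d ℤ).eval M) hmem,
      ← Polynomial.eval_prod, Polynomial.prod_cyclotomic_eq_X_pow_sub_one hpos]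
    simp
  have hpp : Prime (p : ℤ) := Nat.prime_iff_prime_int.1 hp
  rw [hprod] at hdvd
  refine hpp.pow_dvd_of_dvd_mul_right n ?_ hdvd
  intro h
  obtain ⟨d, hd, hpd⟩ := (hpp.dvd_finset_prod_iff _).1 h
  rw [Finset.mem_erase, Nat.mem_divisors] at hd
  obtain ⟨hne, hdd, -⟩ := hd
  have hd0 : 0 < d := Nat.pos_of_dvd_of_pos hdd hpos
  have hlt : d < p := lt_of_le_of_lt (Nat.le_of_dvd hpos hdd) (by omega)
  haveI : NeZero (d : ZMod p) := ⟨fun h0 => by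
    have := Nat.le_of_dvd hd0 ((ZMod.natCast_eq_zero_iff d p).1 h0)
    omega⟩
  have hroot : (Polynomial.cyclotomic d (ZMod p)).IsRoot (M : ZMod p) := by
    have h1 := (ZMod.intCast_zmod_eq_zero_iff_dvd _ p).2 hpd
    rw [Polynomial.IsRoot.def, ← Polynomial.map_cyclotomic_int]
    rw [← h1]
    exact Polynomial.eval_intCast_map (Int.castRingHom (ZMod p)) _ M
  rw [Polynomial.isRoot_cyclotomic_iff] at hroot
  exact hne (by rw [hf]; exact hroot.eq_orderOf)
end

section
/- Let p be an odd prime, s a positive integer, and M > 1 an integer coprime to p with M < p^{2s} (i.e. p^s > √M). Suppose that M is not divisible by any integer x with 1 < x < p^s and x^{p-1} ≡ 1 (mod p^s). Suppose there exist τ ∈ ℤ[ζ] (the ring of integers of the p-th cyclotomic field) and a primitive p-th root of unity ξ such that τ^{p^{s-1}} ≡ ξ (mod M·ℤ[ζ]), i.e. τ^{p^{s-1}} - ξ ∈ M·ℤ[ζ]. Then M is prime. -/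
/-- Sufficient primality condition: let `p` be an odd prime, `s ≥ 1`, `M > 1` coprime
to `p` with `M < p^{2s}`, such that no integer `x` with `1 < x < p^s` and
`x^{p-1} ≡ 1 (mod p^s)` divides `M`. If there are `τ` in the ring of integers
`ℤ[ζ]` of the `p`-th cyclotomic field and a primitive `p`-th root of unity `ξ` with
`τ^{p^{s-1}} ≡ ξ (mod M·ℤ[ζ])`, then `M` is prime. -/
theorem stmt_12 (p : ℕ+) (hp : (p : ℕ).Prime) (hodd : Odd (p : ℕ))
    (s : ℕ) (hs : 0 < s) (M : ℕ) (hM : 1 < M) (hcop : ¬ (p : ℕ) ∣ M)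
    (hlt : M < (p : ℕ) ^ (2 * s))
    (hdiv : ∀ x : ℕ, 1 < x → x < (p : ℕ) ^ s →
      x ^ ((p : ℕ) - 1) ≡ 1 [MOD (p : ℕ) ^ s] → ¬ x ∣ M)
    (τ ξ : NumberField.RingOfIntegers (CyclotomicField p ℚ))
    (hξp : ξ ^ (p : ℕ) = 1) (hξ1 : ξ ≠ 1)
    (hcong : τ ^ ((p : ℕ) ^ (s - 1)) - ξ ∈
      Ideal.span {(M : NumberField.RingOfIntegers (CyclotomicField p ℚ))}) :
    M.Prime := by
  by_contra hnp
  have : Fact (p : ℕ).Prime := ⟨hp⟩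
  have : NeZero (p : ℕ) := ⟨hp.ne_zero⟩
  have hq : (M.minFac).Prime := Nat.minFac_prime (by omega)
  have hqM : M.minFac ∣ M := Nat.minFac_dvd M
  have hsq : M.minFac ^ 2 ≤ M := Nat.minFac_sq_le_self (by omega) hnp
  generalize M.minFac = q at hq hqM hsq
  have : Fact q.Prime := ⟨hq⟩
  have hqlt : q < (p : ℕ) ^ s := by
    have h1 : q ^ 2 < ((p : ℕ) ^ s) ^ 2 := by
      rw [← pow_mul, mul_comm s 2]; omega
    exact lt_of_pow_lt_pow_left₀ 2 (by positivity) h1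
  have hqp : q ≠ (p : ℕ) := by
    rintro rfl; exact hcop hqM
  refine hdiv q hq.one_lt hqlt ?_ hqM
  obtain ⟨Q, hQ, hqQ⟩ : ∃ Q : Ideal (NumberField.RingOfIntegers (CyclotomicField p ℚ)), Q.IsMaximal ∧ (q : (NumberField.RingOfIntegers (CyclotomicField p ℚ))) ∈ Q := by
    have hnu : ¬ IsUnit (q : (NumberField.RingOfIntegers (CyclotomicField p ℚ))) := by
      intro hu
      have h := hu.map (Algebra.norm ℤ)
      have h2 : (q : (NumberField.RingOfIntegers (CyclotomicField p ℚ))) = algebraMap ℤ (NumberField.RingOfIntegers (CyclotomicField p ℚ)) (q : ℤ) := by simp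
      rw [h2, Algebra.norm_algebraMap, isUnit_pow_iff (Module.finrank_pos).ne'] at h
      exact (Nat.prime_iff_prime_int.mp hq).not_isUnit h
    obtain ⟨Q, hQ, h⟩ := Ideal.exists_le_maximal (Ideal.span {(q : (NumberField.RingOfIntegers (CyclotomicField p ℚ)))})
      (by rwa [Ne, Ideal.span_singleton_eq_top])
    exact ⟨Q, hQ, h (Ideal.mem_span_singleton_self _)⟩
  let : Field ((NumberField.RingOfIntegers (CyclotomicField p ℚ)) ⧸ Q) := Ideal.Quotient.field Q
  let φ : (NumberField.RingOfIntegers (CyclotomicField p ℚ)) →+* (NumberField.RingOfIntegers (CyclotomicField p ℚ)) ⧸ Q := Ideal.Quotient.mk Q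
  have hq0 : ((q : ℕ) : (NumberField.RingOfIntegers (CyclotomicField p ℚ)) ⧸ Q) = 0 := by
    have : φ (q : (NumberField.RingOfIntegers (CyclotomicField p ℚ))) = 0 := Ideal.Quotient.eq_zero_iff_mem.mpr hqQ
    rwa [map_natCast] at this
  have : CharP ((NumberField.RingOfIntegers (CyclotomicField p ℚ)) ⧸ Q) q := by
    obtain ⟨r, hr⟩ := CharP.exists ((NumberField.RingOfIntegers (CyclotomicField p ℚ)) ⧸ Q)
    have h1 : r ∣ q := (CharP.cast_eq_zero_iff ((NumberField.RingOfIntegers (CyclotomicField p ℚ)) ⧸ Q) r q).mp hq0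
    rcases (Nat.dvd_prime hq).mp h1 with h | h
    · subst h
      exact absurd rfl (CharP.char_ne_one ((NumberField.RingOfIntegers (CyclotomicField p ℚ)) ⧸ Q) 1)
    · rwa [h] at hr
  have : ExpChar ((NumberField.RingOfIntegers (CyclotomicField p ℚ)) ⧸ Q) q := ExpChar.prime hq
  have hξQ : φ ξ ≠ 1 := by
    intro h
    have h1 : ∑ i ∈ Finset.range (p : ℕ), ξ ^ i = 0 := by
      have h2 := mul_geom_sum ξ (p : ℕ)
      rw [hξp, sub_self] at h2
      exact (mul_eq_zero.mp h2).resolve_left (sub_ne_zero.mpr hξ1)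
    have h2 := congrArg φ h1
    simp only [map_sum, map_pow, h, one_pow, map_zero, Finset.sum_const, Finset.card_range,
      nsmul_eq_mul, mul_one] at h2
    have h3 := (CharP.cast_eq_zero_iff ((NumberField.RingOfIntegers (CyclotomicField p ℚ)) ⧸ Q) q (p : ℕ)).mp h2
    exact hqp ((Nat.prime_dvd_prime_iff_eq hq hp).mp h3)
  have hτ : φ τ ^ ((p : ℕ) ^ (s - 1)) = φ ξ := by
    rw [← map_pow, ← sub_eq_zero, ← map_sub]
    refine Ideal.Quotient.eq_zero_iff_mem.mpr ?_
    obtain ⟨c, hc⟩ := Ideal.mem_span_singleton.mp hcong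
    obtain ⟨d, hd⟩ := hqM
    rw [hc, hd, Nat.cast_mul, mul_assoc]
    exact Q.mul_mem_right _ hqQ
  have hord : orderOf (φ τ) = (p : ℕ) ^ (s - 1 + 1) := by
    apply orderOf_eq_prime_pow
    · rwa [hτ]
    · rw [pow_succ, pow_mul, hτ, ← map_pow, hξp, map_one]
  rw [Nat.sub_add_cancel hs] at hord
  have hfl : q ^ ((p : ℕ) - 1) ≡ 1 [MOD (p : ℕ)] := by
    have := Nat.ModEq.pow_totient ((Nat.coprime_primes hq hp).mpr hqp)
    rwa [Nat.totient_prime hp] at this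
  have hfrob : φ τ ^ (q ^ ((p : ℕ) - 1)) = φ τ := by
    have : NeZero ((p : ℕ) : ℚ) := ⟨by exact_mod_cast hp.ne_zero⟩
    have hcyc := CyclotomicField.isCyclotomicExtension (p : ℕ) ℚ
    have : @IsCyclotomicExtension {(p : ℕ)} ℚ (CyclotomicField p ℚ) _ _ DivisionRing.toRatAlgebra := by
      convert hcyc
      · rfl
      · exact Subsingleton.elim (α := Algebra ℚ (CyclotomicField p ℚ)) _ _
    have hζ := IsCyclotomicExtension.zeta_spec (p : ℕ) ℚ (CyclotomicField p ℚ)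
    have hz := hζ.toInteger_isPrimitiveRoot
    have hmem : τ ∈ Algebra.adjoin ℤ {hζ.toInteger} := by
      have h := hζ.integralPowerBasis.adjoin_gen_eq_top
      rw [IsPrimitiveRoot.integralPowerBasis_gen] at h
      rw [h]; trivial
    have key : ∀ x ∈ Algebra.adjoin ℤ {hζ.toInteger},
        iterateFrobenius ((NumberField.RingOfIntegers (CyclotomicField p ℚ)) ⧸ Q) q ((p : ℕ) - 1) (φ x) = φ x := by
      intro x hx
      induction hx using Algebra.adjoin_induction with
      | mem x hx =>
        rw [Set.mem_singleton_iff.mp hx, iterateFrobenius_def, ← map_pow]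
        congr 1
        have hd := (Nat.modEq_iff_dvd' (Nat.one_le_pow _ _ hq.pos)).mp hfl.symm
        have h1 := (hz.pow_eq_one_iff_dvd _).mpr hd
        rw [← Nat.sub_add_cancel (Nat.one_le_pow ((p : ℕ) - 1) q hq.pos), pow_succ, h1, one_mul]
      | algebraMap r => simp
      | add x y _ _ hx hy => rw [map_add, map_add, hx, hy]
      | mul x y _ _ hx hy => rw [map_mul, map_mul, hx, hy]
    have := key τ hmem
    rwa [iterateFrobenius_def] at this
  have hne : φ τ ≠ 0 := by
    intro h0
    have h1 : orderOf (φ τ) ≠ 0 := by rw [hord]; positivity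
    have h2 := pow_orderOf_eq_one (φ τ)
    rw [h0, zero_pow (h0 ▸ h1)] at h2
    exact zero_ne_one h2
  have hpos : 1 ≤ q ^ ((p : ℕ) - 1) := Nat.one_le_pow _ _ hq.pos
  have hone : φ τ ^ (q ^ ((p : ℕ) - 1) - 1) = 1 := by
    apply mul_right_cancel₀ hne
    rw [← pow_succ, Nat.sub_add_cancel hpos, hfrob, one_mul]
  have hd := orderOf_dvd_of_pow_eq_one hone
  rw [hord] at hd
  exact ((Nat.modEq_iff_dvd' hpos).mpr hd).symm
end

section
/- Let p be an odd prime, r = (p-1)/2, n a positive integer, and M > 1 an integer coprime to p with M < p^{2n}. Suppose that M is not divisible by any integer x with 1 < x < p^n and x^{p-1} ≡ 1 (mod p^n). Let R = ℤ[ζ]/M·ℤ[ζ] and let σ̄_c denote the ring automorphism of R induced by σ_c (which preserves the ideal M·ℤ[ζ]). Let u be a unit of R with u · σ̄_{-1}(u) = 1, set t = u^{p^{n-1}} + σ̄_{-1}(u)^{p^{n-1}}, and for m = 1, …, r set T^{(m)} = e_m(σ̄_1(t), …, σ̄_r(t)) ∈ R, where e_m is the m-th elementary symmetric polynomial. Let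 U^{(m)} = e_m(ζ + ζ^{-1}, ζ^2 + ζ^{-2}, …, ζ^r + ζ^{-r}) ∈ ℤ[ζ]. If T^{(m)} equals the image of U^{(m)} in R for every m = 1, …, r, then M is prime. -/
open MvPolynomial

set_option synthInstance.maxHeartbeats 1000000
set_option maxHeartbeats 1000000

/-- The ring of integers `ℤ[ζ]` of the `p`-th cyclotomic field. -/
abbrev CycInt (p : ℕ+) : Type :=
  NumberField.RingOfIntegers (CyclotomicField p ℚ)

/-- The quotient ring `R = ℤ[ζ]/M·ℤ[ζ]`. -/
abbrev CycIntMod (p : ℕ+) (M : ℕ) : Type :=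
  CycInt p ⧸ Ideal.span {(M : CycInt p)}

theorem aux_esymm {k : Type*} [Field k] {r : ℕ} (w z : Fin r → k)
    (h : ∀ m : ℕ, 1 ≤ m → m ≤ r →
      aeval w (esymm (Fin r) ℤ m) = aeval z (esymm (Fin r) ℤ m)) (i : Fin r) :
    ∃ j, w i = z j := by
  have h' : ∀ m, m ≤ r → (Finset.univ.val.map w).esymm m = (Finset.univ.val.map z).esymm m := by
    intro m hm
    rw [← aeval_esymm_eq_multiset_esymm (Fin r) ℤ, ← aeval_esymm_eq_multiset_esymm (Fin r) ℤ]
    rcases Nat.eq_zero_or_pos m with rfl | h1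
    · simp
    · exact h m h1 hm
  have hP : ((Finset.univ.val.map w).map fun t => Polynomial.X - Polynomial.C t).prod
      = ((Finset.univ.val.map z).map fun t => Polynomial.X - Polynomial.C t).prod := by
    rw [Multiset.prod_X_sub_X_eq_sum_esymm, Multiset.prod_X_sub_X_eq_sum_esymm]
    simp only [Multiset.card_map, Finset.card_val, Finset.card_univ, Fintype.card_fin]
    refine Finset.sum_congr rfl fun m hm => ?_
    rw [h' m (by simpa [Nat.lt_succ_iff] using hm)]
  have hR := congrArg Polynomial.roots hP
  rw [Polynomial.roots_multiset_prod_X_sub_C, Polynomial.roots_multiset_prod_X_sub_C] at hR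
  have : w i ∈ Finset.univ.val.map w := by simp
  rw [hR] at this
  simp only [Multiset.mem_map] at this
  obtain ⟨j, -, hj⟩ := this
  exact ⟨j, hj.symm⟩

theorem aux_core {A k : Type*} [CommRing A] [IsDomain A] [Field k] (φ : A →+* k)
    (hφ : Function.Surjective φ) (p l n : ℕ) (hp : p.Prime) (hl : l.Prime) (hpl : p ≠ l)
    (hlk : (l : k) = 0) (hn : 0 < n) (ζ : A) (hζ : IsPrimitiveRoot ζ p)
    (htop : Algebra.adjoin ℤ ({ζ} : Set A) = ⊤) (a b : k) (hab : a * b = 1)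
    (c : ℕ) (hc : 0 < c) (hcp : c < p)
    (h : a ^ p ^ (n - 1) + b ^ p ^ (n - 1) = φ ζ ^ c + φ ζ ^ (p - c)) :
    l ^ (p - 1) ≡ 1 [MOD p ^ n] := by
  have := Fact.mk hp
  have := Fact.mk hl
  have : CharP k l := by
    obtain ⟨q, hq⟩ := CharP.exists k
    have h1 := (CharP.cast_eq_zero_iff k q l).1 hlk
    rcases (Nat.dvd_prime hl).1 h1 with rfl | rfl
    · exact absurd (CharP.cast_eq_zero k 1) (by rw [Nat.cast_one]; exact one_ne_zero)
    · exact hq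
  have hzp : φ ζ ^ p = 1 := by rw [← map_pow, hζ.pow_eq_one, map_one]
  have hz1 : φ ζ ≠ 1 := by
    intro h1
    have h2 := congrArg φ (hζ.geom_sum_eq_zero hp.one_lt)
    simp only [map_sum, map_pow, h1, one_pow, map_zero, Finset.sum_const, Finset.card_range,
      nsmul_eq_mul, mul_one] at h2
    have h3 := (CharP.cast_eq_zero_iff k l p).1 h2
    exact hpl ((Nat.prime_dvd_prime_iff_eq hl hp).1 h3).symm
  have hord : orderOf (φ ζ) = p := orderOf_eq_prime hzp hz1
  have hne : ∀ d, 0 < d → d < p → φ ζ ^ d ≠ 1 := by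
    intro d hd hdp h1
    have := orderOf_dvd_of_pow_eq_one h1
    rw [hord] at this
    exact absurd (Nat.le_of_dvd hd this) (by omega)
  -- v is a nontrivial p-th root of unity
  have hvv : a ^ p ^ (n - 1) * b ^ p ^ (n - 1) = 1 := by rw [← mul_pow, hab, one_pow]
  have hcc : φ ζ ^ c * φ ζ ^ (p - c) = 1 := by
    rw [← pow_add, Nat.add_sub_cancel' hcp.le, hzp]
  have hv : ∃ d, 0 < d ∧ d < p ∧ a ^ p ^ (n - 1) = φ ζ ^ d := by
    have : (a ^ p ^ (n - 1) - φ ζ ^ c) * (a ^ p ^ (n - 1) - φ ζ ^ (p - c)) = 0 := by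
      linear_combination (a ^ p ^ (n - 1)) * h + hcc - hvv
    rcases mul_eq_zero.1 this with h1 | h1
    · exact ⟨c, hc, hcp, sub_eq_zero.1 h1⟩
    · exact ⟨p - c, by omega, by omega, sub_eq_zero.1 h1⟩
  obtain ⟨d, hd, hdp, hv⟩ := hv
  have hoa : orderOf a = p ^ n := by
    obtain ⟨n', rfl⟩ : ∃ n', n = n' + 1 := ⟨n - 1, by omega⟩
    rw [Nat.add_sub_cancel] at hv
    refine orderOf_eq_prime_pow ?_ ?_
    · rw [hv]; exact hne d hd hdp
    · rw [pow_succ, pow_mul, hv, ← pow_mul, mul_comm, pow_mul, hzp, one_pow]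
  have hmod : l ^ (p - 1) ≡ 1 [MOD p] := by
    rw [← Nat.totient_prime hp]
    exact Nat.ModEq.pow_totient ((Nat.coprime_primes hl hp).2 hpl.symm)
  have hfr : ∀ x : A, φ x ^ l ^ (p - 1) = φ x := by
    intro x
    have hx : x ∈ Algebra.adjoin ℤ ({ζ} : Set A) := by rw [htop]; trivial
    induction hx using Algebra.adjoin_induction with
    | mem x hx =>
      rw [Set.mem_singleton_iff.1 hx]
      rw [← pow_mod_orderOf, hord, hmod, Nat.mod_eq_of_lt hp.one_lt, pow_one]
    | algebraMap m =>
      rw [← iterateFrobenius_def]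
      simp
    | add x y _ _ hx hy => rw [map_add, add_pow_char_pow, hx, hy]
    | mul x y _ _ hx hy => rw [map_mul, mul_pow, hx, hy]
  obtain ⟨x, hx⟩ := hφ a
  have ha := hfr x
  rw [hx] at ha
  conv_rhs at ha => rw [← pow_one a]
  have ha0 : a ≠ 0 := left_ne_zero_of_mul_eq_one hab
  rw [← hoa]
  have h1 : 1 ≤ l ^ (p - 1) := Nat.one_le_pow _ _ hl.pos
  refine ((Nat.modEq_iff_dvd' h1).2 (orderOf_dvd_of_pow_eq_one ?_)).symm
  apply mul_right_cancel₀ ha0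
  rw [← pow_succ, Nat.sub_add_cancel h1, ha, pow_one, one_mul]

/-- Direction (iii) ⟹ (i) of the main theorem: with `R = ℤ[ζ]/M·ℤ[ζ]`, induced
automorphisms `σ̄_c`, a unit `u` of `R` with `u·σ̄₋₁(u) = 1`,
`t = u^{p^{n-1}} + σ̄₋₁(u)^{p^{n-1}}`, `T^{(m)} = e_m(σ̄₁(t), …, σ̄_r(t))` and
`U^{(m)} = e_m(ζ + ζ^{-1}, …, ζ^r + ζ^{-r})`: if `T^{(m)}` equals the image of
`U^{(m)}` in `R` for all `m = 1, …, r`, then `M` is prime. -/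
theorem stmt_13 (p : ℕ+) (hp : (p : ℕ).Prime) (hodd : Odd (p : ℕ))
    (r : ℕ) (hr : r = ((p : ℕ) - 1) / 2)
    (n : ℕ) (hn : 0 < n) (M : ℕ) (hM : 1 < M) (hcop : ¬ (p : ℕ) ∣ M)
    (hlt : M < (p : ℕ) ^ (2 * n))
    (hdiv : ∀ x : ℕ, 1 < x → x < (p : ℕ) ^ n →
      x ^ ((p : ℕ) - 1) ≡ 1 [MOD (p : ℕ) ^ n] → ¬ x ∣ M)
    (ζ : CycInt p) (hζ : IsPrimitiveRoot ζ (p : ℕ))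
    (σbar : ℕ → (CycIntMod p M ≃+* CycIntMod p M))
    (hσbar : ∀ c : ℕ, ¬ (p : ℕ) ∣ c →
      σbar c (Ideal.Quotient.mk (Ideal.span {(M : CycInt p)}) ζ)
        = (Ideal.Quotient.mk (Ideal.span {(M : CycInt p)}) ζ) ^ c)
    (u : CycIntMod p M) (hu : IsUnit u)
    (huσ : u * σbar ((p : ℕ) - 1) u = 1)
    (t : CycIntMod p M)
    (htdef : t = u ^ ((p : ℕ) ^ (n - 1)) + (σbar ((p : ℕ) - 1) u) ^ ((p : ℕ) ^ (n - 1)))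
    (T : ℕ → CycIntMod p M)
    (hTdef : ∀ m : ℕ,
      T m = aeval (fun i : Fin r => σbar ((i : ℕ) + 1) t) (esymm (Fin r) ℤ m))
    (U : ℕ → CycInt p)
    (hUdef : ∀ m : ℕ,
      U m = aeval (fun i : Fin r => ζ ^ ((i : ℕ) + 1) + ζ ^ ((p : ℕ) - ((i : ℕ) + 1)))
        (esymm (Fin r) ℤ m))
    (hTU : ∀ m : ℕ, 1 ≤ m → m ≤ r →
      T m = Ideal.Quotient.mk (Ideal.span {(M : CycInt p)}) (U m)) :
    M.Prime := by
  have : NeZero (p : ℕ) := ⟨hp.ne_zero⟩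
  have key : ∀ l : ℕ, l.Prime → l ∣ M → l ^ ((p : ℕ) - 1) ≡ 1 [MOD (p : ℕ) ^ n] := by
    intro l hl hlM
    have hpl : (p : ℕ) ≠ l := fun h => hcop (h ▸ hlM)
    have : (Ideal.span {(l : ℤ)}).IsMaximal :=
      PrincipalIdealRing.isMaximal_of_irreducible (Nat.prime_iff_prime_int.1 hl).irreducible
    obtain ⟨Q, hQ, hQl⟩ := Ideal.exists_maximal_ideal_liesOver_of_isIntegral
      (S := CycInt p) (Ideal.span {(l : ℤ)})
    have hlQ : (l : CycInt p) ∈ Q := by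
      have h1 : (l : ℤ) ∈ Ideal.span {(l : ℤ)} := Ideal.mem_span_singleton_self _
      rw [hQl.over, Ideal.mem_comap] at h1
      simpa using h1
    have hMQ : Ideal.span {(M : CycInt p)} ≤ Q := by
      rw [Ideal.span_singleton_le_iff_mem]
      obtain ⟨e, rfl⟩ := hlM
      rw [Nat.cast_mul]
      exact Q.mul_mem_right _ hlQ
    let : Field (CycInt p ⧸ Q) := Ideal.Quotient.field Q
    let ψ : CycIntMod p M →+* CycInt p ⧸ Q := Ideal.Quotient.factor hMQ
    have hψ : ∀ x, ψ (Ideal.Quotient.mk _ x) = Ideal.Quotient.mk Q x :=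
      fun x => Ideal.Quotient.factor_mk hMQ x
    have htop : Algebra.adjoin ℤ ({ζ} : Set (CycInt p)) = ⊤ := by
      have : NeZero ((p : ℕ) : ℚ) := ⟨Nat.cast_ne_zero.2 hp.ne_zero⟩
      have : IsCyclotomicExtension {(p : ℕ)} ℚ (CyclotomicField p ℚ) :=
        CyclotomicField.isCyclotomicExtension (p : ℕ) ℚ
      have : IsCyclotomicExtension {(p : ℕ)} ℤ (CycInt p) :=
        IsCyclotomicExtension.ringOfIntegers
      exact IsCyclotomicExtension.adjoin_primitive_root_eq_top hζ
    have hr0 : 0 < r := by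
      have := hp.two_le
      obtain ⟨m, hm⟩ := hodd
      omega
    obtain ⟨j, hj⟩ := aux_esymm
      (fun i : Fin r => ψ (σbar ((i : ℕ) + 1) t))
      (fun i : Fin r => Ideal.Quotient.mk Q (ζ ^ ((i : ℕ) + 1) + ζ ^ ((p : ℕ) - ((i : ℕ) + 1))))
      (by
        intro m h1 h2
        have := congrArg ψ (hTU m h1 h2)
        rw [hψ, hTdef, hUdef] at this
        simpa [esymm, map_sum, map_prod] using this) ⟨0, hr0⟩
    have hjr := j.2
    refine aux_core (Ideal.Quotient.mk Q) Ideal.Quotient.mk_surjective p l n hp hl hpl ?_ hn ζ hζ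
      htop (ψ (σbar 1 u)) (ψ (σbar 1 (σbar ((p : ℕ) - 1) u))) ?_ (j + 1) (by omega) (by omega) ?_
    · rw [← map_natCast (Ideal.Quotient.mk Q)]
      exact Ideal.Quotient.eq_zero_iff_mem.2 hlQ
    · rw [← map_mul, ← map_mul, huσ, map_one, map_one]
    · simpa [htdef] using hj
  by_contra hnp
  have hmf : M.minFac.Prime := Nat.minFac_prime (by omega)
  have h1 := Nat.minFac_sq_le_self (by omega) hnp
  refine hdiv M.minFac hmf.one_lt ?_ (key _ hmf M.minFac_dvd) M.minFac_dvd
  have h2 : M.minFac ^ 2 < ((p : ℕ) ^ n) ^ 2 := by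
    rw [← pow_mul, mul_comm n 2]; omega
  exact lt_of_pow_lt_pow_left₀ 2 (Nat.zero_le _) h2
end
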